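/- Let p : ℕ → (0,1) satisfy n^{−1/2} = o(p(n)) and p(n) = o(1). For each n, let A be a random subset of {0,1,…,n−1} in the binomial model with parameter p(n). Let S^c = (2n−1) − |A+A| be the number of missing sums and D^c = (2n−1) − |A−A| the number of missing differences (A+A ⊆ {0,…,2n−2} and A−A ⊆ {−(n−1),…,n−1} each have 2n−1 possible elements). Then S^c ∼ 2·D^c ∼ 4/p(n)² with probability tending to 1; that is, for every ε > 0, the probability that |S^c·p(n)²/4 − 1| < ε and |D^c·p(n)²/2 − 1| < ε tends to 1 as n → ∞. -/

import Mathlib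

open Finset Filter Asymptotics
open scoped Pointwise Classical

/-- The probability, in the binomial model with parameter `p` on `{0,…,n-1}` (each element
included independently with probability `p`), of the event `P` of random subsets. -/
noncomputable def binomProb (n : ℕ) (p : ℝ) (P : Finset ℤ → Prop) : ℝ :=
  ∑ A ∈ (Finset.Icc (0 : ℤ) ((n : ℤ) - 1)).powerset,
    if P A then p ^ A.card * (1 - p) ^ (n - A.card) else 0


noncomputable def Ex (p : ℝ) (U : Finset ℤ) (f : Finset ℤ → ℝ) : ℝ :=
  ∑ A ∈ U.powerset, p ^ A.card * (1 - p) ^ (U.card - A.card) * f A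

lemma Ex_empty (p : ℝ) (f : Finset ℤ → ℝ) : Ex p ∅ f = f ∅ := by simp [Ex]

lemma Ex_insert (p : ℝ) (U : Finset ℤ) (i : ℤ) (hi : i ∉ U) (f : Finset ℤ → ℝ) :
    Ex p (insert i U) f = (1 - p) * Ex p U f + p * Ex p U (fun A => f (insert i A)) := by
  unfold Ex
  rw [Finset.sum_powerset_insert hi, Finset.mul_sum, Finset.mul_sum]
  congr 1
  · refine Finset.sum_congr rfl fun A hA => ?_
    have hc := Finset.card_le_card (Finset.mem_powerset.1 hA)
    rw [Finset.card_insert_of_notMem hi, Nat.succ_sub hc, pow_succ]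
    ring
  · refine Finset.sum_congr rfl fun A hA => ?_
    have hiA : i ∉ A := fun h => hi (Finset.mem_powerset.1 hA h)
    rw [Finset.card_insert_of_notMem hi, Finset.card_insert_of_notMem hiA, Nat.succ_sub_succ,
      pow_succ]
    ring

lemma Ex_congr (p : ℝ) (U : Finset ℤ) (f g : Finset ℤ → ℝ) (h : ∀ A ⊆ U, f A = g A) :
    Ex p U f = Ex p U g :=
  Finset.sum_congr rfl fun A hA => by rw [h A (Finset.mem_powerset.1 hA)]

lemma Ex_mono (p : ℝ) (h0 : 0 ≤ p) (h1 : p ≤ 1) (U : Finset ℤ) (f g : Finset ℤ → ℝ)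
    (h : ∀ A ⊆ U, f A ≤ g A) : Ex p U f ≤ Ex p U g :=
  Finset.sum_le_sum fun A hA => by
    have := h A (Finset.mem_powerset.1 hA)
    have h2 : 0 ≤ 1 - p := by linarith
    gcongr

lemma Ex_add (p : ℝ) (U : Finset ℤ) (f g : Finset ℤ → ℝ) :
    Ex p U (fun A => f A + g A) = Ex p U f + Ex p U g := by
  unfold Ex; rw [← Finset.sum_add_distrib]; exact Finset.sum_congr rfl fun A _ => by ring

lemma Ex_mul (p : ℝ) (U : Finset ℤ) (c : ℝ) (f : Finset ℤ → ℝ) :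
    Ex p U (fun A => c * f A) = c * Ex p U f := by
  unfold Ex; rw [Finset.mul_sum]; exact Finset.sum_congr rfl fun A _ => by ring

lemma Ex_sum {ι : Type*} (p : ℝ) (U : Finset ℤ) (s : Finset ι) (f : ι → Finset ℤ → ℝ) :
    Ex p U (fun A => ∑ k ∈ s, f k A) = ∑ k ∈ s, Ex p U (f k) := by
  unfold Ex; rw [Finset.sum_comm]; exact Finset.sum_congr rfl fun A _ => by rw [Finset.mul_sum]

lemma Ex_const (p : ℝ) (U : Finset ℤ) (c : ℝ) : Ex p U (fun _ => c) = c := by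
  induction U using Finset.induction_on with
  | empty => simp [Ex_empty]
  | insert i U hi ih => rw [Ex_insert _ _ _ hi, ih]; ring

lemma poincare (p : ℝ) (h0 : 0 ≤ p) (h1 : p ≤ 1) (U : Finset ℤ) : ∀ f : Finset ℤ → ℝ,
    Ex p U (fun A => f A ^ 2) - (Ex p U f) ^ 2 ≤
      p * (1 - p) * ∑ i ∈ U, Ex p U (fun A => (f (insert i A) - f (A.erase i)) ^ 2) := by
  induction U using Finset.induction_on with
  | empty => intro f; simp [Ex_empty]
  | insert j U hj ih =>
    intro f
    have key := ih (fun A => (1 - p) * f A + p * f (insert j A))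
    rw [Finset.sum_insert hj]
    have e1 : Ex p (insert j U) f = Ex p U (fun A => (1 - p) * f A + p * f (insert j A)) := by
      rw [Ex_insert _ _ _ hj, Ex_add, Ex_mul, Ex_mul]
    have e2 : Ex p (insert j U) (fun A => f A ^ 2) =
        Ex p U (fun A => ((1 - p) * f A + p * f (insert j A)) ^ 2) +
        p * (1 - p) * Ex p U (fun A => (f (insert j A) - f A) ^ 2) := by
      rw [Ex_insert _ _ _ hj, ← Ex_mul, ← Ex_mul, ← Ex_mul, ← Ex_add, ← Ex_add]
      congr 1; ext A; ring
    have e3 : Ex p (insert j U) (fun A => (f (insert j A) - f (A.erase j)) ^ 2) =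
        Ex p U (fun A => (f (insert j A) - f A) ^ 2) := by
      rw [Ex_insert _ _ _ hj]
      have a1 : Ex p U (fun A => (f (insert j A) - f (A.erase j)) ^ 2) =
        Ex p U (fun A => (f (insert j A) - f A) ^ 2) := by
        refine Ex_congr _ _ _ _ fun A hA => ?_
        rw [Finset.erase_eq_of_notMem (fun h => hj (hA h))]
      have a2 : Ex p U (fun A => (f (insert j (insert j A)) - f ((insert j A).erase j)) ^ 2) =
        Ex p U (fun A => (f (insert j A) - f A) ^ 2) := by
        refine Ex_congr _ _ _ _ fun A hA => ?_
        rw [Finset.erase_insert (fun h => hj (hA h)), Finset.insert_idem]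
      rw [a1, a2]; ring
    have e4 : ∑ i ∈ U, Ex p U (fun A => (((1 - p) * f (insert i A) + p * f (insert j (insert i A)))
          - ((1 - p) * f (A.erase i) + p * f (insert j (A.erase i)))) ^ 2) ≤
        ∑ i ∈ U, Ex p (insert j U) (fun A => (f (insert i A) - f (A.erase i)) ^ 2) := by
      refine Finset.sum_le_sum fun i hi => ?_
      rw [Ex_insert _ _ _ hj, ← Ex_mul, ← Ex_mul, ← Ex_add]
      refine Ex_mono p h0 h1 _ _ _ fun A hA => ?_
      have hij : j ≠ i := fun h => hj (h ▸ hi)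
      rw [Finset.erase_insert_of_ne hij, Finset.insert_comm i j]
      have : 0 ≤ p * (1 - p) := mul_nonneg h0 (by linarith)
      nlinarith [mul_nonneg this (sq_nonneg ((f (insert i A) - f (A.erase i)) -
        (f (insert j (insert i A)) - f (insert j (A.erase i)))))]
    have hpp : 0 ≤ p * (1 - p) := mul_nonneg h0 (by linarith)
    have := mul_le_mul_of_nonneg_left e4 hpp
    rw [e1, e2, e3]
    linarith

lemma second_moment (p : ℝ) (U W : Finset ℤ) : ∀ c : ℝ,
    Ex p U (fun A => (c + ((A ∩ W).card : ℝ)) ^ 2) =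
      (c + ((U ∩ W).card : ℝ) * p) ^ 2 + ((U ∩ W).card : ℝ) * p * (1 - p) := by
  induction U using Finset.induction_on with
  | empty => intro c; simp [Ex_empty]
  | insert j U hj ih =>
    intro c
    rw [Ex_insert _ _ _ hj]
    by_cases hW : j ∈ W
    · have a2 : Ex p U (fun A => (c + (((insert j A) ∩ W).card : ℝ)) ^ 2) =
        Ex p U (fun A => ((c + 1) + ((A ∩ W).card : ℝ)) ^ 2) := by
        refine Ex_congr _ _ _ _ fun A hA => ?_
        rw [Finset.insert_inter_of_mem hW, Finset.card_insert_of_notMem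
          (fun h => hj (hA (Finset.mem_inter.1 h).1))]
        push_cast; ring
      rw [a2, ih, ih, Finset.insert_inter_of_mem hW, Finset.card_insert_of_notMem
          (fun h => hj (Finset.mem_inter.1 h).1)]
      push_cast; ring
    · have a2 : Ex p U (fun A => (c + (((insert j A) ∩ W).card : ℝ)) ^ 2) =
        Ex p U (fun A => (c + ((A ∩ W).card : ℝ)) ^ 2) := by
        refine Ex_congr _ _ _ _ fun A hA => ?_
        rw [Finset.insert_inter_of_notMem hW]
      rw [a2, ih, Finset.insert_inter_of_notMem hW]
      ring

lemma matching (p : ℝ) (m : ℕ) : ∀ (U : Finset ℤ) (x y : ℕ → ℤ)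
    (_ : ∀ j < m, x j ∈ U) (_ : ∀ j < m, y j ∈ U)
    (_ : ∀ i < m, ∀ j < m, i < j → x i ≠ x j) (_ : ∀ i < m, ∀ j < m, i < j → y i ≠ y j)
    (_ : ∀ i < m, ∀ j < m, x i ≠ y j),
    Ex p U (fun A => if ∀ j < m, ¬ (x j ∈ A ∧ y j ∈ A) then 1 else 0) = (1 - p ^ 2) ^ m := by
  induction m with
  | zero => intros; simp [Ex_const]
  | succ m ih =>
    intro U x y hx hy hxx hyy hxy
    set V := (U.erase (x m)).erase (y m) with hV
    have hyV : y m ∉ V := by simp [hV]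
    have hxV : x m ∉ insert (y m) V := by
      simp [hV, hxy m (by omega) m (by omega)]
    have hU : U = insert (x m) (insert (y m) V) := by
      rw [hV, Finset.insert_erase, Finset.insert_erase (hx m (by omega))]
      exact Finset.mem_erase.2 ⟨(hxy m (by omega) m (by omega)).symm, hy m (by omega)⟩
    have IH := ih V x y
      (fun j hj => Finset.mem_erase.2 ⟨hxy j (by omega) m (by omega),
        Finset.mem_erase.2 ⟨hxx j (by omega) m (by omega) hj, hx j (by omega)⟩⟩)
      (fun j hj => Finset.mem_erase.2 ⟨hyy j (by omega) m (by omega) hj,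
        Finset.mem_erase.2 ⟨(hxy m (by omega) j (by omega)).symm, hy j (by omega)⟩⟩)
      (fun i hi j hj => hxx i (by omega) j (by omega))
      (fun i hi j hj => hyy i (by omega) j (by omega))
      (fun i hi j hj => hxy i (by omega) j (by omega))
    have hne : x m ≠ y m := hxy m (by omega) m (by omega)
    rw [hU, Ex_insert _ _ _ hxV, Ex_insert _ _ _ hyV, Ex_insert _ _ _ hyV]
    have c1 : Ex p V (fun A => if ∀ j < m + 1, ¬ (x j ∈ A ∧ y j ∈ A) then 1 else 0)
        = (1 - p ^ 2) ^ m := by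
      rw [← IH]
      refine Ex_congr _ _ _ _ fun A hA => ?_
      have h1 : y m ∉ A := fun h => hyV (hA h)
      congr 1
      refine propext ⟨fun h j hj => h j (by omega), fun h j hj => ?_⟩
      rcases Nat.lt_succ_iff_lt_or_eq.1 hj with h' | rfl
      · exact h j h'
      · tauto
    have c2 : Ex p V (fun A => if ∀ j < m + 1, ¬ (x j ∈ insert (y m) A ∧ y j ∈ insert (y m) A)
        then 1 else 0) = (1 - p ^ 2) ^ m := by
      rw [← IH]
      refine Ex_congr _ _ _ _ fun A hA => ?_
      have h1 : x m ∉ A := fun h => hxV (Finset.mem_insert_of_mem (hA h))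
      congr 1
      refine propext ⟨fun h j hj => ?_, fun h j hj => ?_⟩
      · have := h j (by omega)
        simp only [Finset.mem_insert] at this; tauto
      rcases Nat.lt_succ_iff_lt_or_eq.1 hj with h' | rfl
      · have := h j h'
        have a := hxy j (by omega) m (by omega)
        have b := hyy j (by omega) m (by omega) h'
        simp only [Finset.mem_insert]; tauto
      · simp only [Finset.mem_insert]; tauto
    have c3 : Ex p V (fun A => if ∀ j < m + 1, ¬ (x j ∈ insert (x m) A ∧ y j ∈ insert (x m) A)
        then 1 else 0) = (1 - p ^ 2) ^ m := by
      rw [← IH]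
      refine Ex_congr _ _ _ _ fun A hA => ?_
      have h1 : y m ∉ A := fun h => hyV (hA h)
      congr 1
      refine propext ⟨fun h j hj => ?_, fun h j hj => ?_⟩
      · have := h j (by omega)
        simp only [Finset.mem_insert] at this; tauto
      rcases Nat.lt_succ_iff_lt_or_eq.1 hj with h' | rfl
      · have := h j h'
        have a := hxx j (by omega) m (by omega) h'
        have b := hxy m (by omega) j (by omega)
        simp only [Finset.mem_insert]; tauto
      · have := hne.symm
        simp only [Finset.mem_insert]; tauto
    have c4 : Ex p V (fun A => if ∀ j < m + 1, ¬ (x j ∈ insert (x m) (insert (y m) A) ∧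
        y j ∈ insert (x m) (insert (y m) A))
        then 1 else 0) = 0 := by
      refine (Ex_congr _ _ _ (fun _ => 0) fun A hA => ?_).trans (Ex_const _ _ _)
      rw [if_neg]
      intro h
      exact h m (by omega) (by simp)
    rw [c1, c2, c3, c4, pow_succ]; ring

lemma Ex_mem (p : ℝ) (U : Finset ℤ) (i : ℤ) (hi : i ∈ U) :
    Ex p U (fun A => if i ∈ A then 1 else 0) = p := by
  rw [← Finset.insert_erase hi, Ex_insert _ _ _ (by simp)]
  rw [Ex_congr p (U.erase i) _ (fun _ => 0), Ex_congr p (U.erase i) (fun A => if i ∈ insert i A then 1 else 0) (fun _ => 1), Ex_const, Ex_const]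
  · ring
  · intro A hA; simp
  · intro A hA
    rw [if_neg]
    intro h; simpa using hA h

def Q (τ σ : ℤ → ℤ) (k : ℕ) (A : Finset ℤ) : Prop := ∀ a ∈ A, ∀ b ∈ A, τ a + σ b ≠ (k : ℤ)

noncomputable def XX (τ σ : ℤ → ℤ) (M : ℕ) (A : Finset ℤ) : ℝ :=
  ∑ k ∈ Finset.range M, if Q τ σ k A then 1 else 0

noncomputable def WW (τ σ : ℤ → ℤ) (M : ℕ) (U : Finset ℤ) : Finset ℤ :=
  U.filter (fun w => τ w < M ∨ σ w < M)

lemma card_aux (τ : ℤ → ℤ) (M : ℕ) (U : Finset ℤ) (h0 : ∀ a ∈ U, 0 ≤ τ a)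
    (hinj : Set.InjOn τ U) : (U.filter (fun w => τ w < M)).card ≤ M := by
  have : (U.filter (fun w => τ w < M)).card ≤ (Finset.Ico (0 : ℤ) M).card := by
    refine Finset.card_le_card_of_injOn τ (fun a ha => ?_) (fun a ha b hb h => ?_)
    · simp only [Finset.coe_filter, Set.mem_ofPred_eq] at ha
      simp [h0 a ha.1, ha.2]
    · simp only [Finset.coe_filter, Set.mem_ofPred_eq] at ha hb
      exact hinj ha.1 hb.1 h
  simpa using this

lemma WW_card (τ σ : ℤ → ℤ) (M : ℕ) (U : Finset ℤ) (h0 : ∀ a ∈ U, 0 ≤ τ a)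
    (h0' : ∀ a ∈ U, 0 ≤ σ a)
    (hinj : Set.InjOn τ U) (hinj' : Set.InjOn σ U) : (WW τ σ M U).card ≤ 2 * M := by
  unfold WW
  rw [Finset.filter_or]
  have := Finset.card_union_le (U.filter (fun w => τ w < M)) (U.filter (fun w => σ w < M))
  have := card_aux τ M U h0 hinj
  have := card_aux σ M U h0' hinj'
  omega

lemma XX_diff (τ σ : ℤ → ℤ) (M : ℕ) (U : Finset ℤ) (h0 : ∀ a ∈ U, 0 ≤ τ a)
    (h0' : ∀ a ∈ U, 0 ≤ σ a) (A : Finset ℤ) (hA : A ⊆ U) (i : ℤ) (hi : i ∈ U) :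
    (XX τ σ M (insert i A) - XX τ σ M (A.erase i)) ^ 2 ≤
      if i ∈ WW τ σ M U then 4 * (1 + ((A ∩ WW τ σ M U).card : ℝ)) ^ 2 else 0 := by
  set W := WW τ σ M U with hW
  set B := A.erase i with hB
  have hiB : insert i A = insert i B := by rw [hB]; ext; simp; tauto
  have hBU : B ⊆ U := (Finset.erase_subset _ _).trans hA
  rw [hiB]
  set S := (Finset.range M).filter (fun k => Q τ σ k B ∧ ¬ Q τ σ k (insert i B)) with hS
  have mono : ∀ k, Q τ σ k (insert i B) → Q τ σ k B := fun k h a ha b hb =>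
    h a (Finset.mem_insert_of_mem ha) b (Finset.mem_insert_of_mem hb)
  have e : XX τ σ M (insert i B) - XX τ σ M B = - (S.card : ℝ) := by
    unfold XX
    rw [hS, Finset.card_filter, ← Finset.sum_sub_distrib]
    push_cast
    rw [← Finset.sum_neg_distrib]
    refine Finset.sum_congr rfl fun k _ => ?_
    have := mono k
    by_cases h1 : Q τ σ k B <;> by_cases h2 : Q τ σ k (insert i B) <;> simp_all
  have wit : ∀ k ∈ S, i ∈ W ∧ ((k : ℤ) = τ i + σ i ∨ (∃ b ∈ B ∩ W, τ i + σ b = (k : ℤ)) ∨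
      ∃ b ∈ B ∩ W, τ b + σ i = (k : ℤ)) := by
    intro k hk
    rw [hS, Finset.mem_filter, Finset.mem_range] at hk
    obtain ⟨hkM, hq, hnq⟩ := hk
    have hkM' : (k : ℤ) < M := by exact_mod_cast hkM
    unfold Q at hnq
    push Not at hnq
    obtain ⟨a, ha, b, hb, hab⟩ := hnq
    have hti := h0 i hi
    have hsi := h0' i hi
    rcases Finset.mem_insert.1 ha with rfl | ha' <;> rcases Finset.mem_insert.1 hb with rfl | hb'
    · refine ⟨?_, Or.inl hab.symm⟩
      rw [hW, WW, Finset.mem_filter]; exact ⟨hi, Or.inl (by omega)⟩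
    · have := h0' b (hBU hb')
      refine ⟨?_, Or.inr (Or.inl ⟨b, ?_, hab⟩)⟩
      · rw [hW, WW, Finset.mem_filter]; exact ⟨hi, Or.inl (by omega)⟩
      · rw [hW, WW, Finset.mem_inter, Finset.mem_filter]
        exact ⟨hb', hBU hb', Or.inr (by omega)⟩
    · have := h0 a (hBU ha')
      refine ⟨?_, Or.inr (Or.inr ⟨a, ?_, hab⟩)⟩
      · rw [hW, WW, Finset.mem_filter]; exact ⟨hi, Or.inr (by omega)⟩
      · rw [hW, WW, Finset.mem_inter, Finset.mem_filter]
        exact ⟨ha', hBU ha', Or.inl (by omega)⟩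
    · exact absurd hab (hq a ha' b hb')
  rw [e, neg_sq]
  split_ifs with hiW
  · have hsub : S ⊆ insert (τ i + σ i).toNat (((B ∩ W).image (fun b => (τ i + σ b).toNat)) ∪
        ((B ∩ W).image (fun b => (τ b + σ i).toNat))) := by
      intro k hk
      obtain ⟨-, h | ⟨b, hb, h⟩ | ⟨b, hb, h⟩⟩ := wit k hk
      · rw [← h]; simp
      · refine Finset.mem_insert_of_mem (Finset.mem_union_left _ (Finset.mem_image.2 ⟨b, hb, ?_⟩))
        rw [h]; simp
      · refine Finset.mem_insert_of_mem (Finset.mem_union_right _ (Finset.mem_image.2 ⟨b, hb, ?_⟩))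
        rw [h]; simp
    have c1 := (Finset.card_le_card hsub).trans (Finset.card_insert_le _ _)
    have c2 := Finset.card_union_le ((B ∩ W).image (fun b => (τ i + σ b).toNat))
        ((B ∩ W).image (fun b => (τ b + σ i).toNat))
    have c3 := Finset.card_image_le (s := B ∩ W) (f := fun b => (τ i + σ b).toNat)
    have c4 := Finset.card_image_le (s := B ∩ W) (f := fun b => (τ b + σ i).toNat)
    have c5 : (B ∩ W).card ≤ (A ∩ W).card :=
      Finset.card_le_card (Finset.inter_subset_inter_right (Finset.erase_subset _ _))
    have c6 : S.card ≤ 2 * (1 + (A ∩ W).card) := by omega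
    have c7 : (S.card : ℝ) ≤ 2 * (1 + ((A ∩ W).card : ℝ)) := by exact_mod_cast c6
    calc (S.card : ℝ) ^ 2 ≤ (2 * (1 + ((A ∩ W).card : ℝ))) ^ 2 := by gcongr
      _ = _ := by ring
  · have : S = ∅ := Finset.eq_empty_of_forall_notMem fun k hk => hiW (wit k hk).1
    simp [this]

lemma XX_var (p : ℝ) (h0p : 0 ≤ p) (h1p : p ≤ 1) (τ σ : ℤ → ℤ) (M : ℕ) (U : Finset ℤ)
    (h0 : ∀ a ∈ U, 0 ≤ τ a) (h0' : ∀ a ∈ U, 0 ≤ σ a)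
    (hinj : Set.InjOn τ U) (hinj' : Set.InjOn σ U) :
    Ex p U (fun A => (XX τ σ M A - Ex p U (XX τ σ M)) ^ 2) ≤
      16 * p * M * (1 + 2 * M * p) ^ 2 := by
  have hP := poincare p h0p h1p U (XX τ σ M)
  set W := WW τ σ M U with hW
  have hWU : U ∩ W = W := Finset.inter_eq_right.2 (Finset.filter_subset _ _)
  have hwc : (W.card : ℝ) ≤ 2 * M := by exact_mod_cast WW_card τ σ M U h0 h0' hinj hinj'
  have eq1 : Ex p U (fun A => (XX τ σ M A - Ex p U (XX τ σ M)) ^ 2) =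
      Ex p U (fun A => XX τ σ M A ^ 2) - (Ex p U (XX τ σ M)) ^ 2 := by
    have : (fun A => (XX τ σ M A - Ex p U (XX τ σ M)) ^ 2) = (fun A => XX τ σ M A ^ 2 +
      ((-2 * Ex p U (XX τ σ M)) * XX τ σ M A + (Ex p U (XX τ σ M)) ^ 2)) := by
      ext A; ring
    rw [this, Ex_add, Ex_add, Ex_mul, Ex_const]; ring
  rw [eq1]
  have hsm : Ex p U (fun A => 4 * (1 + ((A ∩ W).card : ℝ)) ^ 2) ≤ 8 * (1 + 2 * M * p) ^ 2 := by
    rw [Ex_mul, second_moment, hWU]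
    have ha : (W.card : ℝ) * p ≤ 2 * M * p := by gcongr
    have hb : 0 ≤ (W.card : ℝ) * p := by positivity
    generalize (W.card : ℝ) * p = t at *
    have : (1 + t) ^ 2 ≤ (1 + 2 * M * p) ^ 2 := by gcongr
    nlinarith
  have hsum : ∑ i ∈ U, Ex p U (fun A => (XX τ σ M (insert i A) - XX τ σ M (A.erase i)) ^ 2) ≤
      2 * M * (8 * (1 + 2 * M * p) ^ 2) := by
    calc _ ≤ ∑ i ∈ U, if i ∈ W then 8 * (1 + 2 * M * p) ^ 2 else 0 := by
          refine Finset.sum_le_sum fun i hi => ?_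
          refine (Ex_mono p h0p h1p U _ _ fun A hA =>
            XX_diff τ σ M U h0 h0' A hA i hi).trans ?_
          rw [← hW]
          split_ifs with h
          · exact hsm
          · rw [Ex_const]
      _ = W.card * (8 * (1 + 2 * M * p) ^ 2) := by
          rw [← Finset.sum_filter, Finset.filter_mem_eq_inter, hWU, Finset.sum_const, nsmul_eq_mul]
      _ ≤ _ := by gcongr
  have hpp : 0 ≤ p * (1 - p) := mul_nonneg h0p (by linarith)
  refine hP.trans ((mul_le_mul_of_nonneg_left hsum hpp).trans ?_)
  have hz : 0 ≤ p * (2 * M * (8 * (1 + 2 * M * p) ^ 2)) := by positivity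
  nlinarith

lemma sum_half (q : ℝ) (m : ℕ) :
    ∑ k ∈ Finset.range (2 * m), q ^ (k / 2) = 2 * ∑ j ∈ Finset.range m, q ^ j := by
  induction m with
  | zero => simp
  | succ m ih =>
    rw [show 2 * (m + 1) = 2 * m + 1 + 1 by ring, Finset.sum_range_succ, Finset.sum_range_succ, ih,
      Finset.sum_range_succ, show (2 * m + 1) / 2 = m by omega, show (2 * m) / 2 = m by omega]
    ring

lemma geom_p (p : ℝ) (m : ℕ) :
    p ^ 2 * ∑ j ∈ Finset.range m, (1 - p ^ 2) ^ j = 1 - (1 - p ^ 2) ^ m := by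
  have := mul_neg_geom_sum (1 - p ^ 2) m
  rw [← this]; ring

lemma tail_bound (p : ℝ) (h0p : 0 < p) (h1p : p < 1) (M' N : ℕ) :
    p ^ 2 * ∑ k ∈ Finset.Ico (2 * M') N, (1 - p ^ 2) ^ ((k + 1) / 2) ≤ 2 * (1 - p ^ 2) ^ M' := by
  have hq0 : 0 ≤ 1 - p ^ 2 := by nlinarith
  have hq1 : 1 - p ^ 2 ≤ 1 := by nlinarith
  have h1 : ∑ k ∈ Finset.Ico (2 * M') N, (1 - p ^ 2) ^ ((k + 1) / 2) ≤
      (1 - p ^ 2) ^ M' * (2 * ∑ j ∈ Finset.range N, (1 - p ^ 2) ^ j) := by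
    rw [Finset.sum_Ico_eq_sum_range, ← sum_half, Finset.mul_sum]
    calc _ ≤ ∑ k ∈ Finset.range (N - 2 * M'), (1 - p ^ 2) ^ M' * (1 - p ^ 2) ^ (k / 2) := by
          refine Finset.sum_le_sum fun k _ => ?_
          rw [← pow_add]
          exact pow_le_pow_of_le_one hq0 hq1 (by omega)
      _ ≤ _ := by
          refine Finset.sum_le_sum_of_subset_of_nonneg ?_ fun k _ _ => by positivity
          exact Finset.range_subset_range.2 (by omega)
  have h2 := geom_p p N
  have h3 : 0 ≤ (1 - p ^ 2) ^ N := by positivity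
  have h4 : 0 ≤ (1 - p ^ 2) ^ M' := by positivity
  calc _ ≤ p ^ 2 * ((1 - p ^ 2) ^ M' * (2 * ∑ j ∈ Finset.range N, (1 - p ^ 2) ^ j)) := by gcongr
    _ = 2 * (1 - p ^ 2) ^ M' * (1 - (1 - p ^ 2) ^ N) := by rw [← h2]; ring
    _ ≤ _ := by nlinarith [mul_nonneg h4 h3]

lemma family_conc (p : ℝ) (h0p : 0 < p) (h1p : p < 1) (τ σ : ℤ → ℤ) (M' N : ℕ) (hMN : 2 * M' ≤ N)
    (U : Finset ℤ)
    (h0 : ∀ a ∈ U, 0 ≤ τ a) (h0' : ∀ a ∈ U, 0 ≤ σ a)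
    (hinj : Set.InjOn τ U) (hinj' : Set.InjOn σ U) (L δ : ℝ) (hδ : 0 < δ)
    (ha : ∀ k < N, Ex p U (fun A => if Q τ σ k A then 1 else 0) ≤ (1 - p ^ 2) ^ ((k + 1) / 2))
    (hE : |Ex p U (XX τ σ (2 * M')) * p ^ 2 - L| ≤ δ / 3) :
    Ex p U (fun A => if δ ≤ |XX τ σ N A * p ^ 2 - L| then 1 else 0) ≤
      9 * p ^ 4 / δ ^ 2 * (16 * p * (2 * M' : ℕ) * (1 + 2 * (2 * M' : ℕ) * p) ^ 2) +
      6 / δ * (1 - p ^ 2) ^ M' := by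
  set M := 2 * M' with hM
  set m := Ex p U (XX τ σ M) with hm
  set T : Finset ℤ → ℝ := fun A => ∑ k ∈ Finset.Ico M N, if Q τ σ k A then 1 else 0 with hT
  have hsplit : ∀ A, XX τ σ N A = XX τ σ M A + T A := fun A =>
    (Finset.sum_range_add_sum_Ico _ hMN).symm
  have hT0 : ∀ A, 0 ≤ T A := fun A => Finset.sum_nonneg fun k _ => by split_ifs <;> norm_num
  have hpt : ∀ A ⊆ U, (if δ ≤ |XX τ σ N A * p ^ 2 - L| then (1 : ℝ) else 0) ≤
      9 * p ^ 4 / δ ^ 2 * (XX τ σ M A - m) ^ 2 + 3 * p ^ 2 / δ * T A := by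
    intro A _
    have t0 := hT0 A
    have u1 : 0 ≤ 9 * p ^ 4 / δ ^ 2 * (XX τ σ M A - m) ^ 2 := by positivity
    have u2 : 0 ≤ 3 * p ^ 2 / δ * T A := by positivity
    split_ifs with h
    · by_contra! hcon
      have v1 : 9 * p ^ 4 / δ ^ 2 * (XX τ σ M A - m) ^ 2 < 1 := by linarith
      have v2 : 3 * p ^ 2 / δ * T A < 1 := by linarith
      have w1 : |(XX τ σ M A - m) * p ^ 2 * 3 / δ| < 1 := by
        rw [← sq_lt_one_iff_abs_lt_one]
        calc _ = 9 * p ^ 4 / δ ^ 2 * (XX τ σ M A - m) ^ 2 := by field_simp; ring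
          _ < 1 := v1
      have w1' : |(XX τ σ M A - m) * p ^ 2| < δ / 3 := by
        have : (XX τ σ M A - m) * p ^ 2 = ((XX τ σ M A - m) * p ^ 2 * 3 / δ) * (δ / 3) := by
          field_simp
        rw [this, abs_mul, abs_of_pos (show 0 < δ / 3 by positivity)]
        nlinarith
      have w2 : T A * p ^ 2 < δ / 3 := by
        have : T A * p ^ 2 = (3 * p ^ 2 / δ * T A) * (δ / 3) := by field_simp
        rw [this]; nlinarith
      have w3 : 0 ≤ T A * p ^ 2 := by positivity
      rw [hsplit A] at h
      rw [abs_lt] at w1'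
      rw [abs_le] at hE
      have : |(XX τ σ M A + T A) * p ^ 2 - L| < δ := by
        rw [abs_lt]; constructor <;> nlinarith
      linarith
    · positivity
  refine (Ex_mono p h0p.le h1p.le U _ _ hpt).trans ?_
  rw [Ex_add, Ex_mul, Ex_mul]
  have hV := XX_var p h0p.le h1p.le τ σ M U h0 h0' hinj hinj'
  have hTE : Ex p U T ≤ ∑ k ∈ Finset.Ico M N, (1 - p ^ 2) ^ ((k + 1) / 2) := by
    rw [hT, Ex_sum]
    exact Finset.sum_le_sum fun k hk => ha k (Finset.mem_Ico.1 hk).2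
  have htb := tail_bound p h0p h1p M' N
  rw [← hM] at htb
  have h2 : 3 * p ^ 2 / δ * Ex p U T ≤ 6 / δ * (1 - p ^ 2) ^ M' := by
    calc _ ≤ 3 * p ^ 2 / δ * ∑ k ∈ Finset.Ico M N, (1 - p ^ 2) ^ ((k + 1) / 2) := by gcongr
      _ = 3 / δ * (p ^ 2 * ∑ k ∈ Finset.Ico M N, (1 - p ^ 2) ^ ((k + 1) / 2)) := by ring
      _ ≤ 3 / δ * (2 * (1 - p ^ 2) ^ M') := by gcongr
      _ = _ := by ring
  gcongr

lemma sum_upper (p : ℝ) (h0p : 0 ≤ p) (h1p : p ≤ 1) (m : ℕ) (τ : ℤ → ℤ)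
    (hτ : ∀ a ∈ Finset.Icc (0 : ℤ) m, τ a ∈ Finset.Icc (0 : ℤ) m)
    (hinv : ∀ a, τ (τ a) = a) (k : ℕ) (hk : k < m) :
    Ex p (Finset.Icc (0 : ℤ) m) (fun A => if Q τ τ k A then 1 else 0) ≤
      (1 - p ^ 2) ^ ((k + 1) / 2) ∧
    (1 - p ^ 2) ^ ((k + 1) / 2) - p ≤
      Ex p (Finset.Icc (0 : ℤ) m) (fun A => if Q τ τ k A then 1 else 0) := by
  have hinj : ∀ a b, τ a = τ b → a = b := fun a b h => by rw [← hinv a, h, hinv]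
  have hM := matching p ((k + 1) / 2) (Finset.Icc (0 : ℤ) m) (fun j => τ j) (fun j => τ (k - j))
    (fun j hj => hτ _ (by rw [Finset.mem_Icc]; omega))
    (fun j hj => hτ _ (by rw [Finset.mem_Icc]; omega))
    (fun i hi j hj hij h => by have := hinj _ _ h; omega)
    (fun i hi j hj hij h => by have := hinj _ _ h; omega)
    (fun i hi j hj h => by have := hinj _ _ h; omega)
  constructor
  · rw [← hM]
    refine Ex_mono p h0p h1p _ _ _ fun A hA => ?_
    by_cases hq : Q τ τ k A
    · rw [if_pos hq, if_pos]
      rintro j hj ⟨h1, h2⟩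
      refine hq _ h1 _ h2 ?_
      rw [hinv, hinv]; ring
    · rw [if_neg hq]; split_ifs <;> norm_num
  · rw [sub_le_iff_le_add, ← hM]
    have hmem : τ ((k / 2 : ℕ) : ℤ) ∈ Finset.Icc (0 : ℤ) m :=
      hτ _ (by rw [Finset.mem_Icc]; omega)
    have he := Ex_mem p _ _ hmem
    calc _ ≤ Ex p (Finset.Icc (0 : ℤ) m) (fun A => (if Q τ τ k A then 1 else 0) +
          (if τ ((k / 2 : ℕ) : ℤ) ∈ A then 1 else 0)) := by
          refine Ex_mono p h0p h1p _ _ _ fun A hA => ?_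
          by_cases hq : Q τ τ k A
          · rw [if_pos hq]; split_ifs <;> norm_num
          by_cases hmid : τ ((k / 2 : ℕ) : ℤ) ∈ A
          · rw [if_pos hmid]; split_ifs <;> norm_num
          rw [if_neg]
          · split_ifs; norm_num
          intro hno
          unfold Q at hq
          push Not at hq
          obtain ⟨a, ha, b, hb, hab⟩ := hq
          have ha' := Finset.mem_Icc.1 (hτ a (hA ha))
          have hb' := Finset.mem_Icc.1 (hτ b (hA hb))
          rcases lt_trichotomy (τ a) (τ b) with h | h | h
          · refine hno (τ a).toNat (by omega) ⟨?_, ?_⟩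
            · rw [Int.toNat_of_nonneg ha'.1, hinv]; exact ha
            · rw [Int.toNat_of_nonneg ha'.1, show (k : ℤ) - τ a = τ b by omega, hinv]; exact hb
          · apply hmid
            rw [show ((k / 2 : ℕ) : ℤ) = τ a by omega, hinv]; exact ha
          · refine hno (τ b).toNat (by omega) ⟨?_, ?_⟩
            · rw [Int.toNat_of_nonneg hb'.1, hinv]; exact hb
            · rw [Int.toNat_of_nonneg hb'.1, show (k : ℤ) - τ b = τ a by omega, hinv]; exact ha
      _ = _ := by rw [Ex_add, he]

lemma xdiv (d j : ℕ) (hd : 0 < d) (e : ℕ) : (d * (2 * (j / d) + e) + j % d) / d = 2 * (j / d) + e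
    ∧ (d * (2 * (j / d) + e) + j % d) % d = j % d := by
  constructor
  · rw [Nat.mul_add_div hd, Nat.div_eq_of_lt (Nat.mod_lt _ hd)]; rfl
  · rw [Nat.mul_add_mod, Nat.mod_mod]

lemma diff_upper (p : ℝ) (h0p : 0 ≤ p) (h1p : p ≤ 1) (m : ℕ) (k : ℕ) (hk : k < m) :
    Ex p (Finset.Icc (0 : ℤ) m) (fun A => if Q id (fun a => (m : ℤ) - a) k A then 1 else 0) ≤
      (1 - p ^ 2) ^ ((k + 1) / 2) := by
  obtain ⟨d, hd, hdm⟩ : ∃ d : ℕ, 0 < d ∧ k + d = m := ⟨m - k, by omega, by omega⟩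
  have hle : ∀ j, d * (2 * (j / d) + 0) + j % d ≤ 2 * j := fun j => by
    have := Nat.div_add_mod j d
    generalize j / d = u at *
    generalize j % d = v at *
    nlinarith
  have hle' : ∀ j, d * (2 * (j / d) + 1) + j % d ≤ 2 * j + d := fun j => by
    have := Nat.div_add_mod j d
    generalize j / d = u at *
    generalize j % d = v at *
    nlinarith
  have hM := matching p ((k + 1) / 2) (Finset.Icc (0 : ℤ) m)
    (fun j => ((d * (2 * (j / d) + 0) + j % d : ℕ) : ℤ))
    (fun j => ((d * (2 * (j / d) + 1) + j % d : ℕ) : ℤ))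
    (fun j hj => by
      have := hle j
      rw [Finset.mem_Icc]; constructor
      · positivity
      · norm_cast; omega)
    (fun j hj => by
      have := hle' j
      rw [Finset.mem_Icc]; constructor
      · positivity
      · norm_cast; omega)
    (fun i hi j hj hij h => by
      have h : d * (2 * (i / d) + 0) + i % d = d * (2 * (j / d) + 0) + j % d := by exact_mod_cast h
      have a := xdiv d i hd 0
      have b := xdiv d j hd 0
      rw [h] at a
      have h1 : i / d = j / d := by omega
      have h2 : i % d = j % d := by omega
      have h3 := Nat.div_add_mod i d
      have h4 := Nat.div_add_mod j d
      rw [h1, h2] at h3; omega)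
    (fun i hi j hj hij h => by
      have h : d * (2 * (i / d) + 1) + i % d = d * (2 * (j / d) + 1) + j % d := by exact_mod_cast h
      have a := xdiv d i hd 1
      have b := xdiv d j hd 1
      rw [h] at a
      have h1 : i / d = j / d := by omega
      have h2 : i % d = j % d := by omega
      have h3 := Nat.div_add_mod i d
      have h4 := Nat.div_add_mod j d
      rw [h1, h2] at h3; omega)
    (fun i hi j hj h => by
      have h : d * (2 * (i / d) + 0) + i % d = d * (2 * (j / d) + 1) + j % d := by exact_mod_cast h
      have a := xdiv d i hd 0
      have b := xdiv d j hd 1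
      rw [h] at a
      omega)
  rw [← hM]
  refine Ex_mono p h0p h1p _ _ _ fun A hA => ?_
  by_cases hq : Q id (fun a => (m : ℤ) - a) k A
  · rw [if_pos hq, if_pos]
    rintro j hj ⟨h1, h2⟩
    refine hq _ h1 _ h2 ?_
    rw [← hdm]; simp only [id]; push_cast; ring
  · rw [if_neg hq]; split_ifs <;> norm_num

lemma diff_eq (p : ℝ) (m : ℕ) (k : ℕ) (hk : 2 * k < m) :
    Ex p (Finset.Icc (0 : ℤ) m) (fun A => if Q id (fun a => (m : ℤ) - a) k A then 1 else 0) =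
      (1 - p ^ 2) ^ (k + 1) := by
  have hM := matching p (k + 1) (Finset.Icc (0 : ℤ) m)
    (fun j => (j : ℤ)) (fun j => (j : ℤ) + (m - k))
    (fun j hj => by rw [Finset.mem_Icc]; omega)
    (fun j hj => by rw [Finset.mem_Icc]; omega)
    (fun i hi j hj hij h => by omega)
    (fun i hi j hj hij h => by omega)
    (fun i hi j hj h => by omega)
  rw [← hM]
  refine Ex_congr p _ _ _ fun A hA => ?_
  by_cases hq : Q id (fun a => (m : ℤ) - a) k A
  · rw [if_pos hq, if_pos]
    rintro j hj ⟨h1, h2⟩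
    refine hq _ h1 _ h2 ?_
    simp only [id]; ring
  · rw [if_neg hq, if_neg]
    intro hno
    unfold Q at hq
    push Not at hq
    obtain ⟨a, ha, b, hb, hab⟩ := hq
    simp only [id] at hab
    have ha' := Finset.mem_Icc.1 (hA ha)
    have hb' := Finset.mem_Icc.1 (hA hb)
    refine hno a.toNat (by omega) ⟨?_, ?_⟩
    · rw [Int.toNat_of_nonneg ha'.1]; exact ha
    · rw [Int.toNat_of_nonneg ha'.1, show a + ((m : ℤ) - k) = b by omega]; exact hb

lemma E_sum (p : ℝ) (h0p : 0 < p) (h1p : p < 1) (m : ℕ) (τ : ℤ → ℤ)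
    (hτ : ∀ a ∈ Finset.Icc (0 : ℤ) m, τ a ∈ Finset.Icc (0 : ℤ) m)
    (hinv : ∀ a, τ (τ a) = a) (M' : ℕ) (hk : 2 * M' ≤ m) :
    |Ex p (Finset.Icc (0 : ℤ) m) (XX τ τ (2 * M')) * p ^ 2 - 2| ≤
      2 * (1 - p ^ 2) ^ M' + 2 * p ^ 2 + 2 * M' * p ^ 3 := by
  have hq0 : 0 ≤ 1 - p ^ 2 := by nlinarith
  have hq1 : 1 - p ^ 2 ≤ 1 := by nlinarith
  have hX : Ex p (Finset.Icc (0 : ℤ) m) (XX τ τ (2 * M')) = ∑ k ∈ Finset.range (2 * M'),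
      Ex p (Finset.Icc (0 : ℤ) m) (fun A => if Q τ τ k A then 1 else 0) := by
    rw [← Ex_sum]; rfl
  have hb := fun k (h : k ∈ Finset.range (2 * M')) => sum_upper p h0p.le h1p.le m τ hτ hinv k
    (by have := Finset.mem_range.1 h; omega)
  have hu : Ex p (Finset.Icc (0 : ℤ) m) (XX τ τ (2 * M')) ≤
      2 * ∑ j ∈ Finset.range M', (1 - p ^ 2) ^ j := by
    rw [hX, ← sum_half]
    refine Finset.sum_le_sum fun k h => (hb k h).1.trans ?_
    exact pow_le_pow_of_le_one hq0 hq1 (by omega)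
  have hl : (1 - p ^ 2) * (2 * ∑ j ∈ Finset.range M', (1 - p ^ 2) ^ j) - (2 * M' : ℕ) * p ≤
      Ex p (Finset.Icc (0 : ℤ) m) (XX τ τ (2 * M')) := by
    have : ((2 * M' : ℕ) : ℝ) * p = ∑ k ∈ Finset.range (2 * M'), p := by simp
    rw [hX, ← sum_half, this, Finset.mul_sum, ← Finset.sum_sub_distrib]
    refine Finset.sum_le_sum fun k h => le_trans ?_ (hb k h).2
    rw [← pow_succ']
    exact sub_le_sub_right (pow_le_pow_of_le_one hq0 hq1 (by omega)) _
  have hg := geom_p p M'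
  set G := ∑ j ∈ Finset.range M', (1 - p ^ 2) ^ j
  set E := Ex p (Finset.Icc (0 : ℤ) m) (XX τ τ (2 * M'))
  have hp2 : 0 ≤ p ^ 2 := by positivity
  have h3 := mul_le_mul_of_nonneg_right hu hp2
  have h4 := mul_le_mul_of_nonneg_right hl hp2
  push_cast at h4
  have hqM : 0 ≤ (1 - p ^ 2) ^ M' := by positivity
  have hr : 0 ≤ 2 * M' * p ^ 3 := by positivity
  rw [abs_le]
  constructor
  · have : ((1 - p ^ 2) * (2 * G) - 2 * M' * p) * p ^ 2 =
      2 * (1 - p ^ 2) * (p ^ 2 * G) - 2 * M' * p ^ 3 := by ring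
    rw [this, hg] at h4
    nlinarith [mul_nonneg hp2 hqM]
  · have : 2 * G * p ^ 2 = 2 * (p ^ 2 * G) := by ring
    rw [this, hg] at h3
    linarith

lemma E_diff (p : ℝ) (h0p : 0 < p) (h1p : p < 1) (m : ℕ) (M' : ℕ) (hk : 4 * M' ≤ m) :
    |Ex p (Finset.Icc (0 : ℤ) m) (XX id (fun a => (m : ℤ) - a) (2 * M')) * p ^ 2 - 1| ≤
      2 * (1 - p ^ 2) ^ M' + 2 * p ^ 2 + 2 * M' * p ^ 3 := by
  have hq0 : 0 ≤ 1 - p ^ 2 := by nlinarith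
  have hq1 : 1 - p ^ 2 ≤ 1 := by nlinarith
  have hX : Ex p (Finset.Icc (0 : ℤ) m) (XX id (fun a => (m : ℤ) - a) (2 * M')) =
      (1 - p ^ 2) * ∑ k ∈ Finset.range (2 * M'), (1 - p ^ 2) ^ k := by
    unfold XX
    rw [Ex_sum, Finset.mul_sum]
    refine Finset.sum_congr rfl fun k h => ?_
    rw [diff_eq p m k (by have := Finset.mem_range.1 h; omega), pow_succ']
  have hg := geom_p p (2 * M')
  have : Ex p (Finset.Icc (0 : ℤ) m) (XX id (fun a => (m : ℤ) - a) (2 * M')) * p ^ 2 =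
      (1 - p ^ 2) * (1 - (1 - p ^ 2) ^ (2 * M')) := by rw [hX, ← hg]; ring
  rw [this]
  have hp2 : 0 ≤ p ^ 2 := by positivity
  have hqM : 0 ≤ (1 - p ^ 2) ^ M' := by positivity
  have hqM2 : 0 ≤ (1 - p ^ 2) ^ (2 * M') := by positivity
  have hqM3 : (1 - p ^ 2) ^ (2 * M') ≤ (1 - p ^ 2) ^ M' :=
    pow_le_pow_of_le_one hq0 hq1 (by omega)
  have hr : 0 ≤ 2 * M' * p ^ 3 := by positivity
  rw [abs_le]
  constructor <;> nlinarith [mul_nonneg hp2 hqM2, mul_nonneg hq0 hqM2]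

lemma numeric (δ : ℝ) (hδ : 0 < δ) : ∃ K > 0, ∃ p0 > 0, ∀ (p : ℝ) (m : ℕ), 0 < p → p < 1 → p ≤ p0 →
    K ≤ m * p ^ 2 → ∃ M' : ℕ, 4 * M' ≤ m ∧
      2 * (1 - p ^ 2) ^ M' + 2 * p ^ 2 + 2 * M' * p ^ 3 ≤ δ / 3 ∧
      9 * p ^ 4 / δ ^ 2 * (16 * p * (2 * M' : ℕ) * (1 + 2 * (2 * M' : ℕ) * p) ^ 2) +
      6 / δ * (1 - p ^ 2) ^ M' ≤ δ := by
  obtain ⟨c, hc0, hc1, hc2⟩ : ∃ c : ℝ, 0 < c ∧ 12 / δ ≤ c ∧ 12 / δ ^ 2 ≤ c :=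
    ⟨12 / δ + 12 / δ ^ 2, by positivity, by simp; positivity, by simp; positivity⟩
  rw [div_le_iff₀ (by positivity)] at hc1 hc2
  refine ⟨4 * (c + 1), by positivity,
    min (δ / (12 * (c + 2))) (δ ^ 3 / (576 * ((c + 1) * (4 * c + 5) ^ 2))), by positivity, ?_⟩
  intro p m h0 h1 hp0 hK
  have hpa := hp0.trans (min_le_left _ _)
  have hpb := hp0.trans (min_le_right _ _)
  rw [le_div_iff₀ (by positivity)] at hpa hpb
  set M' := ⌈c / p ^ 2⌉₊ with hM'
  have hp2 : 0 < p ^ 2 := by positivity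
  have hp21 : p ^ 2 ≤ 1 := by nlinarith
  have lo : c ≤ M' * p ^ 2 := by
    have := Nat.le_ceil (c / p ^ 2)
    rwa [div_le_iff₀ hp2] at this
  have hi : M' * p ^ 2 ≤ c + 1 := by
    have := (Nat.ceil_lt_add_one (show 0 ≤ c / p ^ 2 by positivity)).le
    calc (M' : ℝ) * p ^ 2 ≤ (c / p ^ 2 + 1) * p ^ 2 := by gcongr
      _ = c + p ^ 2 := by field_simp
      _ ≤ c + 1 := by linarith
  have hq0 : 0 ≤ 1 - p ^ 2 := by linarith
  have hqM0 : 0 ≤ (1 - p ^ 2) ^ M' := by positivity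
  have hq : (1 - p ^ 2) ^ M' * c ≤ 1 := by
    have e1 : (1 - p ^ 2) ^ M' ≤ Real.exp (-(M' * p ^ 2)) := by
      have : 1 - p ^ 2 ≤ Real.exp (-p ^ 2) := by
        have := Real.add_one_le_exp (-p ^ 2); linarith
      calc _ ≤ (Real.exp (-p ^ 2)) ^ M' := by gcongr
        _ = _ := by rw [← Real.exp_nat_mul]; congr 1; ring
    have e2 : c ≤ Real.exp (M' * p ^ 2) := by
      have := Real.add_one_le_exp (M' * p ^ 2); linarith
    calc _ ≤ Real.exp (-(M' * p ^ 2)) * Real.exp (M' * p ^ 2) := by gcongr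
      _ = 1 := by rw [← Real.exp_add]; simp
  refine ⟨M', ?_, ?_, ?_⟩
  · have : (4 * M' : ℝ) * p ^ 2 ≤ m * p ^ 2 := by linarith
    have := le_of_mul_le_mul_right this hp2
    exact_mod_cast this
  · have a1 : (1 - p ^ 2) ^ M' * 12 ≤ δ := by
      calc _ ≤ (1 - p ^ 2) ^ M' * (c * δ) := by gcongr
        _ = (1 - p ^ 2) ^ M' * c * δ := by ring
        _ ≤ 1 * δ := by gcongr
        _ = δ := one_mul _
    have a2 : M' * p ^ 3 ≤ (c + 1) * p := by
      calc _ = M' * p ^ 2 * p := by ring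
        _ ≤ _ := by gcongr
    have a3 : p ^ 2 ≤ p := by nlinarith
    linarith
  · have b1 : 6 / δ * (1 - p ^ 2) ^ M' ≤ δ / 2 := by
      rw [div_mul_eq_mul_div, div_le_iff₀ hδ]
      have : (1 - p ^ 2) ^ M' * 12 ≤ δ ^ 2 := by
        calc _ ≤ (1 - p ^ 2) ^ M' * (c * δ ^ 2) := by gcongr
          _ = (1 - p ^ 2) ^ M' * c * δ ^ 2 := by ring
          _ ≤ 1 * δ ^ 2 := by gcongr
          _ = δ ^ 2 := one_mul _
      nlinarith
    have b2 : 9 * p ^ 4 / δ ^ 2 * (16 * p * (2 * M' : ℕ) * (1 + 2 * (2 * M' : ℕ) * p) ^ 2)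
        ≤ δ / 2 := by
      calc _ = 288 / δ ^ 2 * p * ((M' * p ^ 2) * (p + 4 * (M' * p ^ 2)) ^ 2) := by
            push_cast; ring
        _ ≤ 288 / δ ^ 2 * p * ((c + 1) * (1 + 4 * (c + 1)) ^ 2) := by gcongr
        _ = (p * (576 * ((c + 1) * (4 * c + 5) ^ 2))) / (2 * δ ^ 2) := by
            field_simp; ring
        _ ≤ δ ^ 3 / (2 * δ ^ 2) := by gcongr
        _ = δ / 2 := by field_simp
    linarith

lemma uniform_conc (δ : ℝ) (hδ : 0 < δ) : ∃ K > 0, ∃ p0 > 0, ∀ (p : ℝ) (m : ℕ),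
    0 < p → p < 1 → p ≤ p0 → K ≤ m * p ^ 2 →
    Ex p (Finset.Icc (0 : ℤ) m)
      (fun A => if δ ≤ |XX id id m A * p ^ 2 - 2| then 1 else 0) ≤ δ ∧
    Ex p (Finset.Icc (0 : ℤ) m)
      (fun A => if δ ≤ |XX (fun a => (m : ℤ) - a) (fun a => (m : ℤ) - a) m A * p ^ 2 - 2|
        then 1 else 0) ≤ δ ∧
    Ex p (Finset.Icc (0 : ℤ) m)
      (fun A => if δ ≤ |XX id (fun a => (m : ℤ) - a) m A * p ^ 2 - 1| then 1 else 0) ≤ δ := by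
  obtain ⟨K, hK, p0, hp0, H⟩ := numeric δ hδ
  refine ⟨K, hK, p0, hp0, fun p m h0 h1 hp hm => ?_⟩
  obtain ⟨M', hM, hR, hB⟩ := H p m h0 h1 hp hm
  have n1 : ∀ a ∈ Finset.Icc (0 : ℤ) m, 0 ≤ id a := fun a ha => (Finset.mem_Icc.1 ha).1
  have n2 : ∀ a ∈ Finset.Icc (0 : ℤ) m, 0 ≤ (fun a => (m : ℤ) - a) a := fun a ha => by
    have := (Finset.mem_Icc.1 ha).2
    simp only; omega
  have i1 : Set.InjOn (id : ℤ → ℤ) (Finset.Icc (0 : ℤ) m) := Function.injective_id.injOn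
  have i2 : Set.InjOn (fun a => (m : ℤ) - a) (Finset.Icc (0 : ℤ) m) :=
    fun a _ b _ h => by simp only at h; omega
  have m1 : ∀ a ∈ Finset.Icc (0 : ℤ) m, id a ∈ Finset.Icc (0 : ℤ) m := fun a ha => ha
  have m2 : ∀ a ∈ Finset.Icc (0 : ℤ) m, (fun a => (m : ℤ) - a) a ∈ Finset.Icc (0 : ℤ) m :=
    fun a ha => by
      rw [Finset.mem_Icc] at *
      simp only; omega
  have v2 : ∀ a, (fun a => (m : ℤ) - a) ((fun a => (m : ℤ) - a) a) = a := fun a => by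
    simp
  refine ⟨?_, ?_, ?_⟩
  · refine (family_conc p h0 h1 _ _ M' m (by omega) _ n1 n1 i1 i1 2 δ hδ ?_ ?_).trans hB
    · exact fun k hk => (sum_upper p h0.le h1.le m id m1 (fun _ => rfl) k hk).1
    · exact (E_sum p h0 h1 m id m1 (fun _ => rfl) M' (by omega)).trans hR
  · refine (family_conc p h0 h1 _ _ M' m (by omega) _ n2 n2 i2 i2 2 δ hδ ?_ ?_).trans hB
    · exact fun k hk => (sum_upper p h0.le h1.le m _ m2 v2 k hk).1
    · exact (E_sum p h0 h1 m _ m2 v2 M' (by omega)).trans hR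
  · refine (family_conc p h0 h1 _ _ M' m (by omega) _ n1 n2 i1 i2 1 δ hδ ?_ ?_).trans hB
    · exact fun k hk => diff_upper p h0.le h1.le m k hk
    · exact (E_diff p h0 h1 m M' hM).trans hR

lemma count_missing (m : ℕ) (φ : ℤ → ℤ) (hφ : Function.Injective φ) (B : Finset ℤ)
    (hB : ∀ b ∈ B, ∃ k < 2 * m + 1, φ (k : ℕ) = b) :
    (2 * ((m + 1 : ℕ) : ℝ) - 1) - (B.card : ℝ) =
      ∑ k ∈ Finset.range m, (if φ k ∉ B then 1 else 0) + (if φ m ∉ B then 1 else 0) +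
      ∑ k ∈ Finset.range m, (if φ (2 * m - k) ∉ B then 1 else 0) := by
  have h1 : (B.card : ℝ) = ∑ k ∈ Finset.range (2 * m + 1), if φ k ∈ B then 1 else 0 := by
    rw [← Finset.sum_filter, Finset.sum_const, nsmul_eq_mul, mul_one]
    congr 1
    symm
    refine Finset.card_bij (fun k _ => φ k) ?_ ?_ ?_
    · intro k hk; exact (Finset.mem_filter.1 hk).2
    · intro a _ b _ h; exact_mod_cast hφ h
    · intro b hb
      obtain ⟨k, hk, rfl⟩ := hB b hb
      exact ⟨k, Finset.mem_filter.2 ⟨Finset.mem_range.2 hk, hb⟩, rfl⟩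
  have h2 : (2 * ((m + 1 : ℕ) : ℝ) - 1) - (B.card : ℝ) =
      ∑ k ∈ Finset.range (2 * m + 1), if φ k ∉ B then (1 : ℝ) else 0 := by
    have : (2 * ((m + 1 : ℕ) : ℝ) - 1) = ∑ k ∈ Finset.range (2 * m + 1), (1 : ℝ) := by
      simp; ring
    rw [this, h1, ← Finset.sum_sub_distrib]
    refine Finset.sum_congr rfl fun k _ => ?_
    by_cases h : φ k ∈ B <;> simp [h]
  rw [h2, show 2 * m + 1 = m + 1 + m by ring, Finset.sum_range_add, Finset.sum_range_succ]
  congr 1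
  rw [← Finset.sum_range_reflect]
  refine Finset.sum_congr rfl fun k hk => ?_
  have hk := Finset.mem_range.1 hk
  rw [show ((m + 1 + (m - 1 - k) : ℕ) : ℤ) = 2 * m - k by omega]

lemma count_S (m : ℕ) (A : Finset ℤ) (hA : A ⊆ Finset.Icc (0 : ℤ) m) :
    |(2 * ((m + 1 : ℕ) : ℝ) - 1) - ((A + A).card : ℝ) - (XX id id m A +
      XX (fun a => (m : ℤ) - a) (fun a => (m : ℤ) - a) m A)| ≤ 1 := by
  rw [count_missing m id Function.injective_id]
  · have e1 : ∑ k ∈ Finset.range m, (if id (k : ℤ) ∉ A + A then (1 : ℝ) else 0) = XX id id m A := by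
      refine Finset.sum_congr rfl fun k _ => ?_
      congr 1
      simp only [Q, Finset.mem_add, id, eq_iff_iff]
      push Not; rfl
    have e2 : ∑ k ∈ Finset.range m, (if id (2 * (m : ℤ) - k) ∉ A + A then (1 : ℝ) else 0) =
        XX (fun a => (m : ℤ) - a) (fun a => (m : ℤ) - a) m A := by
      refine Finset.sum_congr rfl fun k _ => ?_
      congr 1
      simp only [Q, Finset.mem_add, id, eq_iff_iff]
      push Not
      refine forall₂_congr fun a _ => forall₂_congr fun b _ => ?_
      omega
    rw [e1, e2]
    split_ifs <;> rw [abs_le] <;> constructor <;> linarith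
  · intro b hb
    obtain ⟨x, hx, y, hy, rfl⟩ := Finset.mem_add.1 hb
    have hx := Finset.mem_Icc.1 (hA hx)
    have hy := Finset.mem_Icc.1 (hA hy)
    exact ⟨(x + y).toNat, by omega, by simp only [id]; omega⟩

lemma count_D (m : ℕ) (A : Finset ℤ) (hA : A ⊆ Finset.Icc (0 : ℤ) m) :
    |(2 * ((m + 1 : ℕ) : ℝ) - 1) - ((A - A).card : ℝ) -
      2 * XX id (fun a => (m : ℤ) - a) m A| ≤ 1 := by
  rw [count_missing m (fun k => (m : ℤ) - k) (fun a b h => by simp only at h; omega)]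
  · have e1 : ∑ k ∈ Finset.range m, (if (m : ℤ) - (k : ℤ) ∉ A - A then (1 : ℝ) else 0) =
        XX id (fun a => (m : ℤ) - a) m A := by
      refine Finset.sum_congr rfl fun k _ => ?_
      congr 1
      simp only [Q, Finset.mem_sub, id, eq_iff_iff]
      push Not
      constructor
      · intro h a ha b hb; have := h b hb a ha; omega
      · intro h a ha b hb; have := h b hb a ha; omega
    have e2 : ∑ k ∈ Finset.range m, (if (m : ℤ) - (2 * (m : ℤ) - k) ∉ A - A then (1 : ℝ) else 0) =
        XX id (fun a => (m : ℤ) - a) m A := by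
      refine Finset.sum_congr rfl fun k _ => ?_
      congr 1
      simp only [Q, Finset.mem_sub, id, eq_iff_iff]
      push Not
      refine forall₂_congr fun a _ => forall₂_congr fun b _ => ?_
      omega
    rw [e1, e2]
    split_ifs <;> rw [abs_le] <;> constructor <;> linarith
  · intro b hb
    obtain ⟨x, hx, y, hy, rfl⟩ := Finset.mem_sub.1 hb
    have hx := Finset.mem_Icc.1 (hA hx)
    have hy := Finset.mem_Icc.1 (hA hy)
    exact ⟨(m - (x - y)).toNat, by omega, by omega⟩

lemma binomProb_eq (m : ℕ) (p : ℝ) (P : Finset ℤ → Prop) :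
    binomProb (m + 1) p P = Ex p (Finset.Icc (0 : ℤ) m) (fun A => if P A then 1 else 0) := by
  unfold binomProb Ex
  have : (Finset.Icc (0 : ℤ) (((m + 1 : ℕ) : ℤ) - 1)) = Finset.Icc (0 : ℤ) m := by
    congr 1; push_cast; ring
  rw [this]
  refine Finset.sum_congr rfl fun A _ => ?_
  simp

lemma main_bound (ε : ℝ) (hε : 0 < ε) (η : ℝ) (hη : 0 < η) : ∃ K > 0, ∃ p0 > 0, ∀ (p : ℝ) (m : ℕ),
    0 < p → p < 1 → p ≤ p0 → K ≤ m * p ^ 2 →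
    |binomProb (m + 1) p (fun A =>
          |((2 * ((m + 1 : ℕ) : ℝ) - 1) - ((A + A).card : ℝ)) * p ^ 2 / 4 - 1| < ε ∧
          |((2 * ((m + 1 : ℕ) : ℝ) - 1) - ((A - A).card : ℝ)) * p ^ 2 / 2 - 1| < ε) - 1| < η := by
  obtain ⟨δ, hδ, hd1, hd2⟩ : ∃ δ > 0, 2 * δ ≤ ε ∧ 4 * δ ≤ η :=
    ⟨min (ε / 2) (η / 4), by positivity, by have := min_le_left (ε / 2) (η / 4); linarith,
      by have := min_le_right (ε / 2) (η / 4); linarith⟩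
  obtain ⟨K, hK, p0, hp0, H⟩ := uniform_conc δ hδ
  refine ⟨K, hK, min p0 δ, by positivity, fun p m h0 h1 hp hm => ?_⟩
  obtain ⟨H1, H2, H3⟩ := H p m h0 h1 (hp.trans (min_le_left _ _)) hm
  have hpd := hp.trans (min_le_right _ _)
  set U := Finset.Icc (0 : ℤ) m
  obtain ⟨P, hP⟩ : ∃ P : Finset ℤ → Prop, P = (fun A =>
          |((2 * ((m + 1 : ℕ) : ℝ) - 1) - ((A + A).card : ℝ)) * p ^ 2 / 4 - 1| < ε ∧
          |((2 * ((m + 1 : ℕ) : ℝ) - 1) - ((A - A).card : ℝ)) * p ^ 2 / 2 - 1| < ε) := ⟨_, rfl⟩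
  rw [← hP, binomProb_eq]
  have up : Ex p U (fun A => if P A then 1 else 0) ≤ 1 := by
    refine (Ex_mono p h0.le h1.le U _ (fun _ => 1) fun A _ => ?_).trans (Ex_const p U 1).le
    split_ifs <;> norm_num
  have lo : 1 ≤ Ex p U (fun A => (if P A then 1 else 0) +
      ((if δ ≤ |XX id id m A * p ^ 2 - 2| then 1 else 0) +
      ((if δ ≤ |XX (fun a => (m : ℤ) - a) (fun a => (m : ℤ) - a) m A * p ^ 2 - 2|
        then 1 else 0) +
      (if δ ≤ |XX id (fun a => (m : ℤ) - a) m A * p ^ 2 - 1| then 1 else 0)))) := by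
    refine (Ex_const p U 1).ge.trans (Ex_mono p h0.le h1.le U (fun _ => 1) _ fun A hA => ?_)
    have cS := count_S m A hA
    have cD := count_D m A hA
    by_cases k1 : δ ≤ |XX id id m A * p ^ 2 - 2|
    · rw [if_pos k1]; split_ifs <;> norm_num
    by_cases k2 : δ ≤ |XX (fun a => (m : ℤ) - a) (fun a => (m : ℤ) - a) m A * p ^ 2 - 2|
    · rw [if_pos k2]; split_ifs <;> norm_num
    by_cases k3 : δ ≤ |XX id (fun a => (m : ℤ) - a) m A * p ^ 2 - 1|
    · rw [if_pos k3]; split_ifs <;> norm_num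
    rw [if_pos]
    · split_ifs; norm_num
    have hpp : p ^ 2 ≤ δ := by nlinarith
    have hp2 : 0 ≤ p ^ 2 := by positivity
    rw [not_le, abs_lt] at k1 k2 k3
    rw [abs_le] at cS cD
    rw [hP]
    have s1 := mul_le_mul_of_nonneg_right cS.1 hp2
    have s2 := mul_le_mul_of_nonneg_right cS.2 hp2
    have s3 := mul_le_mul_of_nonneg_right cD.1 hp2
    have s4 := mul_le_mul_of_nonneg_right cD.2 hp2
    refine ⟨?_, ?_⟩
    · rw [abs_lt]; constructor <;> linarith
    · rw [abs_lt]; constructor <;> linarith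
  rw [Ex_add, Ex_add, Ex_add] at lo
  rw [abs_lt]; constructor <;> linarith

theorem missing_sums_asymptotics_dense (p : ℕ → ℝ) (hp : ∀ n, 0 < p n ∧ p n < 1)
    (hlower : (fun n : ℕ => ((n : ℝ)) ^ (-(1 / 2) : ℝ)) =o[Filter.atTop] p)
    (hupper : p =o[Filter.atTop] (fun _ : ℕ => (1 : ℝ))) :
    ∀ ε : ℝ, 0 < ε →
      Filter.Tendsto
        (fun n : ℕ => binomProb n (p n) (fun A =>
          |((2 * (n : ℝ) - 1) - ((A + A).card : ℝ)) * p n ^ 2 / 4 - 1| < ε ∧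
          |((2 * (n : ℝ) - 1) - ((A - A).card : ℝ)) * p n ^ 2 / 2 - 1| < ε))
        Filter.atTop (nhds 1) := by
  intro ε hε
  rw [Metric.tendsto_nhds]
  intro η hη
  obtain ⟨K, hK, p0, hp0, H⟩ := main_bound ε hε η hη
  have hc : 0 < 1 / Real.sqrt (K + 1) := by positivity
  filter_upwards [hlower.def hc, hupper.def hp0, Filter.eventually_ge_atTop 1] with n h1 h2 hn
  obtain ⟨q0, q1⟩ := hp n
  have hn0 : (0 : ℝ) < n := by exact_mod_cast hn
  rw [Real.norm_of_nonneg (by positivity), Real.norm_of_nonneg q0.le] at h1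
  rw [Real.norm_of_nonneg q0.le] at h2
  have h3 : (K + 1) ≤ n * p n ^ 2 := by
    rw [Real.rpow_neg hn0.le, ← Real.sqrt_eq_rpow, div_mul_eq_mul_div, one_mul,
      le_div_iff₀ (by positivity), inv_mul_le_iff₀ (by positivity)] at h1
    have := pow_le_pow_left₀ (by positivity) h1 2
    rw [mul_pow, Real.sq_sqrt (by positivity), Real.sq_sqrt (by positivity)] at this
    exact this
  obtain ⟨m, rfl⟩ : ∃ m, n = m + 1 := ⟨n - 1, by omega⟩
  rw [Real.dist_eq]
  refine H (p (m + 1)) m q0 q1 (by simpa using h2) ?_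
  push_cast at h3
  nlinarith
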